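/- arXiv:hep-th/9907049 — 5 statements merged into one kernel-verified Lean document; each statement's English description precedes it below -/
import Mathlib

section
/- Let F : ℕ → ℝ be given by F(n) = n (the harmonic oscillator case). Then for all n, j ≥ 0, Δ_F(n+1, j) = (n+2j)! / (n! · 2^j · j!). -/
/-- `Delta F m j` is the quantity `Δ_F(m, j)` defined by `Δ_F(m, 0) = 1` and
`Δ_F(m, j) = ∑_{k=1}^{m} F(k) · Δ_F(k+1, j−1)` for `j ≥ 1`. -/
noncomputable def Delta (F : ℕ → ℝ) : ℕ → ℕ → ℝ
  | _, 0 => 1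
  | m, j + 1 => ∑ k ∈ Finset.Icc 1 m, F k * Delta F (k + 1) j
  termination_by m j => j

/-- In the harmonic oscillator case `F(n) = n`, one has
`Δ_F(n+1, j) = (n+2j)! / (n! · 2^j · j!)`. -/
theorem delta_harmonic_oscillator (n j : ℕ) :
    Delta (fun k => (k : ℝ)) (n + 1) j =
      (Nat.factorial (n + 2 * j) : ℝ) /
        ((Nat.factorial n : ℝ) * 2 ^ j * (Nat.factorial j : ℝ)) := by
  induction j generalizing n with
  | zero => simp [Delta, Nat.factorial_ne_zero]
  | succ j ihj =>
    induction n with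
    | zero =>
      rw [Delta, zero_add, Finset.Icc_self, Finset.sum_singleton, ihj,
        show 0 + 2 * (j + 1) = (1 + 2 * j) + 1 by ring, Nat.factorial_succ (1 + 2 * j),
        Nat.factorial_succ j]
      push_cast [Nat.factorial_zero, Nat.factorial_one]
      field_simp
      ring
    | succ n ihn =>
      rw [Delta, Finset.sum_Icc_succ_top (by omega), ← Delta, ihn, ihj,
        show n + 1 + 2 * (j + 1) = (n + 2 * (j + 1)) + 1 by ring,
        Nat.factorial_succ (n + 2 * (j + 1)),
        show n + 1 + 1 + 2 * j = n + 2 * (j + 1) by ring,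
        Nat.factorial_succ (n + 1), Nat.factorial_succ n, Nat.factorial_succ j]
      push_cast
      field_simp
      ring
end

section
/- Let F : ℕ → ℝ be given by F(n) = n. Then for every n ≥ 0 and every r ∈ ℝ, the series ∑_{j=0}^{∞} (n!/(n+2j)!) · Δ_F(n+1, j) · (−r²)^j converges with sum e^{−r²/2}; in particular the sum is independent of n. -/
theorem Delta_succ_succ (F : ℕ → ℝ) (m j : ℕ) :
    Delta F (m + 1) (j + 1) = Delta F m (j + 1) + F (m + 1) * Delta F (m + 2) j := by
  rw [Delta, Delta, Finset.sum_Icc_succ_top (by omega)]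

theorem Delta_natCast_succ (n j : ℕ) :
    Delta (fun k => (k : ℝ)) (n + 1) j =
      (Nat.factorial (n + 2 * j) : ℝ) / (Nat.factorial n * (2 ^ j * Nat.factorial j)) := by
  induction j generalizing n with
  | zero =>
    have := Nat.factorial_ne_zero n
    simp [Delta, this]
  | succ j ih =>
    induction n with
    | zero =>
      rw [Delta_succ_succ, ih, Delta, show 0 + 2 * (j + 1) = (1 + 2 * j) + 1 by ring]
      simp only [Nat.factorial_succ j, Nat.factorial_succ (1 + 2 * j)]
      have := Nat.factorial_ne_zero j
      simp only [Finset.Icc_eq_empty_of_lt zero_lt_one, Finset.sum_empty, Nat.factorial_zero,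
        Nat.factorial_one]
      push_cast
      field_simp
      ring
    | succ n ihn =>
      rw [Delta_succ_succ, ihn, ih, show n + 1 + 1 + 2 * j = n + 2 * (j + 1) by ring,
        show n + 1 + 2 * (j + 1) = n + 2 * (j + 1) + 1 by ring]
      simp only [Nat.factorial_succ j, Nat.factorial_succ n, Nat.factorial_succ (n + 1),
        Nat.factorial_succ (n + 2 * (j + 1))]
      have := Nat.factorial_ne_zero j
      have := Nat.factorial_ne_zero n
      push_cast
      field_simp
      ring

/-- In the harmonic oscillator case `F(n) = n`, for every `n` and every real `r`, the series
`∑_j (n!/(n+2j)!) · Δ_F(n+1, j) · (−r²)^j` converges with sum `e^{−r²/2}`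
(in particular the sum is independent of `n`). -/
theorem series_harmonic_oscillator (n : ℕ) (r : ℝ) :
    HasSum
      (fun j : ℕ =>
        (Nat.factorial n : ℝ) / (Nat.factorial (n + 2 * j) : ℝ) *
          Delta (fun k => (k : ℝ)) (n + 1) j * (-r ^ 2) ^ j)
      (Real.exp (-r ^ 2 / 2)) := by
  have h := NormedSpace.expSeries_div_hasSum_exp (-r ^ 2 / 2)
  rw [← Real.exp_eq_exp_ℝ] at h
  have hterm (j : ℕ) : (Nat.factorial n : ℝ) / (Nat.factorial (n + 2 * j) : ℝ) *
      Delta (fun k => (k : ℝ)) (n + 1) j * (-r ^ 2) ^ j =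
      (-r ^ 2 / 2) ^ j / (Nat.factorial j : ℝ) := by
    have := Nat.factorial_ne_zero j
    have := Nat.factorial_ne_zero n
    have := Nat.factorial_ne_zero (n + 2 * j)
    rw [Delta_natCast_succ, div_pow]
    field_simp
  simpa only [hterm] using h
end

section
/- Let F : ℕ → ℝ be arbitrary and, for each n ≥ 0, let I_n ∈ ℝ⟦X⟧ be the formal power series whose coefficient of X^{n+2j} is (−1)^j · (n!/(n+2j)!) · Δ_F(n+1, j) for j ≥ 0 and whose other coefficients are zero. Then the formal derivative of I_n satisfies I_n' = n · I_{n−1} − (F(n+1)/(n+1)) · I_{n+1} for every n ≥ 1, and I_0' = −F(1) · I_1. -/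
/-- The formal power series `I_n` whose coefficient of `X^{n+2j}` is
`(−1)^j (n!/(n+2j)!) Δ_F(n+1, j)` and whose other coefficients vanish. -/
noncomputable def Iser (F : ℕ → ℝ) (n : ℕ) : PowerSeries ℝ :=
  PowerSeries.mk fun m =>
    if n ≤ m ∧ (m - n) % 2 = 0 then
      (-1 : ℝ) ^ ((m - n) / 2) * ((Nat.factorial n : ℝ) / (Nat.factorial m : ℝ)) *
        Delta F (n + 1) ((m - n) / 2)
    else 0

theorem coeff_derivativeFun_apply (f : PowerSeries ℝ) (m : ℕ) :
    PowerSeries.coeff m (PowerSeries.derivativeFun f) =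
      PowerSeries.coeff (m + 1) f * ((m : ℝ) + 1) :=
  PowerSeries.coeff_derivative f m

theorem Delta_zero_right (F : ℕ → ℝ) (m : ℕ) : Delta F m 0 = 1 := by
  rw [Delta]

theorem Delta_zero_succ (F : ℕ → ℝ) (j : ℕ) : Delta F 0 (j + 1) = 0 := by
  rw [Delta]
  simp

theorem coeff_Iser_add_two_mul (F : ℕ → ℝ) (n j : ℕ) :
    PowerSeries.coeff (n + 2 * j) (Iser F n) =
      (-1 : ℝ) ^ j * ((n.factorial : ℝ) / ((n + 2 * j).factorial : ℝ)) * Delta F (n + 1) j := by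
  simp [Iser]

theorem coeff_Iser_eq_zero (F : ℕ → ℝ) {n m : ℕ} (h : m < n ∨ (m - n) % 2 = 1) :
    PowerSeries.coeff m (Iser F n) = 0 := by
  rw [Iser, PowerSeries.coeff_mk, if_neg (by omega)]

/-- The formal power series `I_n` satisfy `I_n' = n I_{n−1} − (F(n+1)/(n+1)) I_{n+1}`
for `n ≥ 1`, and `I_0' = −F(1) I_1`. -/
theorem Iser_derivative (F : ℕ → ℝ) :
    (∀ n : ℕ, 1 ≤ n →
      PowerSeries.derivativeFun (Iser F n) =
        (n : ℝ) • Iser F (n - 1) - (F (n + 1) / ((n : ℝ) + 1)) • Iser F (n + 1)) ∧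
    PowerSeries.derivativeFun (Iser F 0) = (-F 1) • Iser F 1 := by
  refine ⟨fun n hn => ?_, ?_⟩
  · obtain ⟨p, rfl⟩ : ∃ p, n = p + 1 := ⟨n - 1, by omega⟩
    ext m
    rw [coeff_derivativeFun_apply]
    simp only [map_sub, PowerSeries.coeff_smul,
      Nat.add_sub_cancel, smul_eq_mul]
    by_cases h : m < p ∨ (m - p) % 2 = 1
    · rw [coeff_Iser_eq_zero F (by omega), coeff_Iser_eq_zero F (by omega),
        coeff_Iser_eq_zero F (by omega)]
      ring
    obtain ⟨j, rfl⟩ : ∃ j, m = p + 2 * j := ⟨(m - p) / 2, by omega⟩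
    rw [show p + 2 * j + 1 = (p + 1) + 2 * j by ring, coeff_Iser_add_two_mul,
      coeff_Iser_add_two_mul]
    have hfac : ((p + 2 * j).factorial : ℝ) ≠ 0 := by positivity
    have hsucc : ((p : ℝ) + 2 * j + 1) ≠ 0 := by positivity
    rw [show p + 1 + 2 * j = (p + 2 * j) + 1 by ring, Nat.factorial_succ (p + 2 * j),
      Nat.factorial_succ p]
    cases j with
    | zero =>
      rw [coeff_Iser_eq_zero F (by omega), Delta_zero_right, Delta_zero_right]
      push_cast at hfac hsucc ⊢
      field_simp
      ring
    | succ i =>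
      have hI := coeff_Iser_add_two_mul F (p + 1 + 1) i
      rw [show p + 1 + 1 + 2 * i = p + 2 * (i + 1) by ring, Nat.factorial_succ (p + 1),
        Nat.factorial_succ p] at hI
      rw [hI, Delta_succ_succ]
      have hp : ((p : ℝ) + 1 + 1) ≠ 0 := by positivity
      push_cast at hfac hsucc ⊢
      field_simp
      ring
  · ext m
    rw [coeff_derivativeFun_apply]
    simp only [PowerSeries.coeff_smul, smul_eq_mul]
    by_cases h : m % 2 = 0
    · rw [coeff_Iser_eq_zero F (by omega), coeff_Iser_eq_zero F (by omega)]
      ring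
    obtain ⟨j, rfl⟩ : ∃ j, m = 1 + 2 * j := ⟨m / 2, by omega⟩
    rw [coeff_Iser_add_two_mul, show 1 + 2 * j + 1 = 0 + 2 * (j + 1) by ring,
      coeff_Iser_add_two_mul, Delta_succ_succ, Delta_zero_succ,
      show 0 + 2 * (j + 1) = (1 + 2 * j) + 1 by ring, Nat.factorial_succ (1 + 2 * j)]
    have hfac : ((1 + 2 * j).factorial : ℝ) ≠ 0 := by positivity
    have hsucc : (1 + 2 * (j : ℝ) + 1) ≠ 0 := by positivity
    push_cast
    simp only [Nat.factorial_zero, Nat.factorial_one, Nat.cast_one]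
    field_simp
    ring
end

section
/- Let K ≥ 1/2 be a real number and let F : ℕ → ℝ be given by F(k) = k(2K+k−1). Then for every r ∈ ℝ with |r| < π/2, the series ∑_{j=0}^{∞} (−1)^j · Δ_F(1, j) · r^{2j}/(2j)! converges (HasSum) with sum (cosh r)^{−2K}. -/
theorem Delta_one_succ (F : ℕ → ℝ) (j : ℕ) :
    Delta F 1 (j + 1) = F 1 * Delta F 2 j := by
  rw [Delta, Finset.Icc_self, Finset.sum_singleton]

/-- The function `sinh ^ h * cosh ^ (-2K - h) / h!`. -/
noncomputable def sechTanh (K : ℝ) (h : ℕ) (z : ℂ) : ℂ :=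
  Complex.sinh z ^ h * Complex.cosh z ^ (-(2 * K : ℂ) - h) / (h.factorial : ℂ)

theorem Complex.cosh_mem_slitPlane {z : ℂ} (hz : |z.im| < Real.pi / 2) :
    Complex.cosh z ∈ Complex.slitPlane := by
  left
  have hre : (Complex.cosh z).re = Real.cosh z.re * Real.cos z.im := by
    conv_lhs => rw [← Complex.re_add_im z]
    rw [Complex.cosh_add, Complex.cosh_mul_I, Complex.sinh_mul_I]
    simp [← Complex.ofReal_cosh, ← Complex.ofReal_cos, ← Complex.ofReal_sinh,
      ← Complex.ofReal_sin]
  rw [hre]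
  exact mul_pos (Real.cosh_pos _) (Real.cos_pos_of_mem_Ioo ⟨(abs_lt.1 hz).1, (abs_lt.1 hz).2⟩)

theorem isOpen_abs_im_lt (a : ℝ) : IsOpen {z : ℂ | |z.im| < a} :=
  isOpen_lt (by fun_prop) continuous_const

theorem hasDerivAt_sechTanh_zero (K : ℝ) {z : ℂ} (hz : |z.im| < Real.pi / 2) :
    HasDerivAt (sechTanh K 0) (-(2 * K : ℂ) * sechTanh K 1 z) z := by
  have h := (Complex.hasDerivAt_cosh z).cpow_const (c := -(2 * K : ℂ))
    (Complex.cosh_mem_slitPlane hz)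
  have hfun : sechTanh K 0 = fun z => Complex.cosh z ^ (-(2 * K : ℂ)) := by
    ext z; simp [sechTanh]
  rw [hfun]
  convert h using 1
  simp [sechTanh]
  ring

theorem hasDerivAt_sechTanh_succ (K : ℝ) (h : ℕ) {z : ℂ} (hz : |z.im| < Real.pi / 2) :
    HasDerivAt (sechTanh K (h + 1))
      (sechTanh K h z - ((h + 2) * (2 * K + h + 1) : ℂ) * sechTanh K (h + 2) z) z := by
  have hmem := Complex.cosh_mem_slitPlane hz
  have hd := ((((Complex.hasDerivAt_sinh z).fun_pow (h + 1)).fun_mul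
    ((Complex.hasDerivAt_cosh z).cpow_const (c := -(2 * K : ℂ) - (h + 1 : ℕ)) hmem))).div_const
      ((h + 1).factorial : ℂ)
  refine hd.congr_deriv ?_
  have hne : Complex.cosh z ≠ 0 := Complex.slitPlane_ne_zero hmem
  have hexp : Complex.cosh z ^ (-(2 * K : ℂ) - h) =
      Complex.cosh z ^ (-(2 * K : ℂ) - (h + 1 : ℕ)) * Complex.cosh z := by
    nth_rewrite 3 [← Complex.cpow_one (Complex.cosh z)]
    rw [← Complex.cpow_add _ _ hne]
    congr 1
    push_cast
    ring
  have hexp' : Complex.cosh z ^ (-(2 * K : ℂ) - (h + 2 : ℕ)) =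
      Complex.cosh z ^ (-(2 * K : ℂ) - (h + 1 : ℕ) - 1) := by
    congr 1
    push_cast
    ring
  have hfac : (h.factorial : ℂ) ≠ 0 := by exact_mod_cast h.factorial_ne_zero
  have h1 : (h + 1 : ℂ) ≠ 0 := by exact_mod_cast h.succ_ne_zero
  have h2 : (h + 1 + 1 : ℂ) ≠ 0 := by exact_mod_cast (h + 1).succ_ne_zero
  simp only [sechTanh, hexp, hexp', Nat.factorial_succ]
  push_cast
  field_simp
  ring

theorem differentiableOn_sechTanh (K : ℝ) (h : ℕ) :
    DifferentiableOn ℂ (sechTanh K h) {z | |z.im| < Real.pi / 2} := by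
  intro z hz
  cases h with
  | zero => exact (hasDerivAt_sechTanh_zero K hz).differentiableAt.differentiableWithinAt
  | succ h => exact (hasDerivAt_sechTanh_succ K h hz).differentiableAt.differentiableWithinAt

theorem strip_mem_nhds_zero : {z : ℂ | |z.im| < Real.pi / 2} ∈ nhds (0 : ℂ) :=
  (isOpen_abs_im_lt _).mem_nhds (by simp [Real.pi_pos])

theorem contDiffAt_sechTanh (K : ℝ) (h n : ℕ) : ContDiffAt ℂ n (sechTanh K h) 0 :=
  ((differentiableOn_sechTanh K h).analyticAt strip_mem_nhds_zero).contDiffAt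

theorem iteratedDeriv_succ_sechTanh_zero (K : ℝ) (n : ℕ) :
    iteratedDeriv (n + 1) (sechTanh K 0) 0 =
      -(2 * K : ℂ) * iteratedDeriv n (sechTanh K 1) 0 := by
  have heq : deriv (sechTanh K 0) =ᶠ[nhds 0] fun z => -(2 * K : ℂ) * sechTanh K 1 z := by
    filter_upwards [strip_mem_nhds_zero] with z hz
    exact (hasDerivAt_sechTanh_zero K hz).deriv
  rw [iteratedDeriv_succ', heq.iteratedDeriv_eq,
    iteratedDeriv_const_mul _ (contDiffAt_sechTanh K 1 n)]

theorem iteratedDeriv_succ_sechTanh_succ (K : ℝ) (h n : ℕ) :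
    iteratedDeriv (n + 1) (sechTanh K (h + 1)) 0 =
      iteratedDeriv n (sechTanh K h) 0 -
        ((h + 2) * (2 * K + h + 1) : ℂ) * iteratedDeriv n (sechTanh K (h + 2)) 0 := by
  have heq : deriv (sechTanh K (h + 1)) =ᶠ[nhds 0] fun z =>
      sechTanh K h z - ((h + 2) * (2 * K + h + 1) : ℂ) * sechTanh K (h + 2) z := by
    filter_upwards [strip_mem_nhds_zero] with z hz
    exact (hasDerivAt_sechTanh_succ K h hz).deriv
  rw [iteratedDeriv_succ', heq.iteratedDeriv_eq,
    iteratedDeriv_fun_sub (contDiffAt_sechTanh K h n)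
      (contDiffAt_const.mul (contDiffAt_sechTanh K (h + 2) n)),
    iteratedDeriv_const_mul _ (contDiffAt_sechTanh K (h + 2) n)]

theorem iteratedDeriv_sechTanh_eq_zero (K : ℝ) (n h : ℕ) (hn : ∀ j, n ≠ h + 2 * j) :
    iteratedDeriv n (sechTanh K h) 0 = 0 := by
  induction n generalizing h with
  | zero =>
    have : h ≠ 0 := fun h0 => hn 0 (by omega)
    simp [sechTanh, this]
  | succ n ih =>
    cases h with
    | zero =>
      rw [iteratedDeriv_succ_sechTanh_zero, ih 1 fun j hj => hn (j + 1) (by omega), mul_zero]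
    | succ h =>
      rw [iteratedDeriv_succ_sechTanh_succ, ih h fun j hj => hn j (by omega),
        ih (h + 2) fun j hj => hn (j + 1) (by omega), mul_zero, sub_zero]

theorem iteratedDeriv_sechTanh (K : ℝ) (n h j : ℕ) (hn : n = h + 2 * j) :
    iteratedDeriv n (sechTanh K h) 0 =
      (((-1 : ℝ) ^ j * Delta (fun k => (k : ℝ) * (2 * K + (k : ℝ) - 1)) (h + 1) j : ℝ) : ℂ) := by
  induction n generalizing h j with
  | zero =>
    obtain ⟨rfl, rfl⟩ : h = 0 ∧ j = 0 := by omega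
    simp [sechTanh, Delta]
  | succ n ih =>
    cases h with
    | zero =>
      obtain ⟨j, rfl⟩ : ∃ i, j = i + 1 := ⟨j - 1, by omega⟩
      rw [iteratedDeriv_succ_sechTanh_zero, ih 1 j (by omega), zero_add, Delta_one_succ]
      push_cast
      ring
    | succ h =>
      rw [iteratedDeriv_succ_sechTanh_succ, ih h j (by omega)]
      cases j with
      | zero =>
        rw [iteratedDeriv_sechTanh_eq_zero K n (h + 2) fun j hj => by omega]
        simp [Delta]
      | succ j =>
        rw [ih (h + 2) j (by omega), Delta_succ_succ _ (h + 1) j]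
        push_cast
        ring

/-- In the spin-`K` case `F(k) = k(2K+k−1)` with `K ≥ 1/2`, for `|r| < π/2` the series
`∑_j (−1)^j Δ_F(1, j) r^{2j}/(2j)!` converges with sum `(cosh r)^{−2K}`. -/
theorem generalized_euler_series (K : ℝ) (hK : 1 / 2 ≤ K) (r : ℝ) (hr : |r| < Real.pi / 2) :
    HasSum
      (fun j : ℕ =>
        (-1 : ℝ) ^ j * Delta (fun k => (k : ℝ) * (2 * K + (k : ℝ) - 1)) 1 j *
          r ^ (2 * j) / (Nat.factorial (2 * j) : ℝ))
      (Real.cosh r ^ (-(2 * K))) := by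
  have hball : DifferentiableOn ℂ (sechTanh K 0) (Metric.ball 0 (Real.pi / 2)) :=
    (differentiableOn_sechTanh K 0).mono fun z hz =>
      (Complex.abs_im_le_norm z).trans_lt (by simpa using hz)
  have hsum := Complex.hasSum_taylorSeries_on_ball hball (z := (r : ℂ)) (by simpa using hr)
  have hinj : Function.Injective fun j : ℕ => 2 * j := fun a b hab => by simpa using hab
  rw [← hinj.hasSum_iff] at hsum
  · rw [← Complex.hasSum_ofReal]
    convert hsum using 1
    · rfl
    · funext j
      simp only [Function.comp_apply, iteratedDeriv_sechTanh K (2 * j) 0 j (by omega), zero_add,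
        sub_zero, smul_eq_mul]
      push_cast
      ring
    · simp [sechTanh, Complex.ofReal_cpow (Real.cosh_pos r).le]
  · intro n hn
    rw [iteratedDeriv_sechTanh_eq_zero K n 0 fun j hj => hn ⟨j, by simp [hj]⟩]
    simp
end

section
/- Let F : ℕ → ℝ be given by F(k) = k², and set D_j = Δ_F(1, j). Then D_0 = 1 and for every n ≥ 1, ∑_{k=0}^{n} (−1)^k · binom(2n, 2k) · D_{n−k} = 0. Consequently D_j equals the j-th Euler number E_j defined by the recurrence E_0 = 1, ∑_{k=0}^{n} (−1)^k binom(2n,2k) E_{n−k} = 0. -/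
namespace PowerSeries

open scoped Nat

theorem derivative_cos : derivative ℝ (cos ℝ) = -sin ℝ := by
  ext n
  rw [coeff_derivative, map_neg, cos, sin, coeff_mk, coeff_mk]
  rcases Nat.even_or_odd n with h | h
  · simp [h, Nat.even_add_one]
  · obtain ⟨k, rfl⟩ := h
    have h1 : Even (2 * k + 1 + 1) := ⟨k + 1, by ring⟩
    have h2 : ¬ Even (2 * k + 1) := by simp
    have h3 : (2 * k + 1 + 1) / 2 = k + 1 := by omega
    have h4 : (2 * k + 1) / 2 = k := by omega
    rw [if_pos h1, if_neg h2, h3, h4, Nat.factorial_succ (2 * k + 1)]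
    simp only [eq_ratCast]
    push_cast
    field_simp
    ring

theorem derivative_sin : derivative ℝ (sin ℝ) = cos ℝ := by
  ext n
  rw [coeff_derivative, cos, sin, coeff_mk, coeff_mk]
  rcases Nat.even_or_odd n with h | h
  · obtain ⟨k, rfl⟩ := h
    have h1 : Even (k + k) := ⟨k, rfl⟩
    have h2 : ¬ Even (k + k + 1) := by simp [Nat.even_add_one]
    have h3 : (k + k + 1) / 2 = k := by omega
    have h4 : (k + k) / 2 = k := by omega
    rw [if_pos h1, if_neg h2, h3, h4, Nat.factorial_succ (k + k)]
    simp only [eq_ratCast]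
    push_cast
    field_simp
  · have h1 : ¬ Even n := Nat.not_even_iff_odd.mpr h
    simp [h1, Nat.even_add_one]

theorem constantCoeff_cos : constantCoeff (cos ℝ) = 1 := by
  rw [← coeff_zero_eq_constantCoeff_apply, cos, coeff_mk]
  simp

theorem constantCoeff_sin : constantCoeff (sin ℝ) = 0 := by
  rw [← coeff_zero_eq_constantCoeff_apply, sin, coeff_mk]
  simp

theorem cos_sq_add_sin_sq : cos ℝ ^ 2 + sin ℝ ^ 2 = 1 := by
  apply derivative.ext
  · rw [map_add, derivative_pow, derivative_pow, derivative_cos, derivative_sin,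
      derivative_one]
    push_cast
    ring
  · simp [constantCoeff_cos, constantCoeff_sin]

/-- The formal power series of the secant function. -/
noncomputable def sec : PowerSeries ℝ := (cos ℝ)⁻¹

/-- The formal power series of the tangent function. -/
noncomputable def tan : PowerSeries ℝ := sin ℝ * sec

theorem cos_mul_sec : cos ℝ * sec = 1 :=
  PowerSeries.mul_inv_cancel _ (by simp [constantCoeff_cos])

theorem derivative_sec : derivative ℝ sec = sec * tan := by
  rw [tan, sec, derivative_inv', derivative_cos]
  ring

theorem derivative_tan : derivative ℝ tan = 1 + tan ^ 2 := by
  rw [tan, Derivation.leibniz, derivative_sec, derivative_sin, tan, smul_eq_mul, smul_eq_mul]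
  linear_combination cos_mul_sec

theorem constantCoeff_sec : constantCoeff sec = 1 := by
  simp [sec, constantCoeff_cos]

theorem constantCoeff_tan : constantCoeff tan = 0 := by
  simp [tan, constantCoeff_sin]

/-- The formal power series of `sec x * tan x ^ m / m!`. -/
noncomputable def secTan (m : ℕ) : PowerSeries ℝ := C (m ! : ℝ)⁻¹ * (sec * tan ^ m)

theorem derivative_sec_mul_tan_pow_succ (m : ℕ) :
    derivative ℝ (sec * tan ^ (m + 1)) =
      C (m + 1 : ℝ) * (sec * tan ^ m) + C (m + 2 : ℝ) * (sec * tan ^ (m + 2)) := by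
  rw [Derivation.leibniz, derivative_pow, derivative_sec, derivative_tan, smul_eq_mul,
    smul_eq_mul]
  simp only [map_add, map_natCast, map_one, map_ofNat, Nat.add_sub_cancel]
  push_cast
  ring

theorem derivative_secTan_zero : derivative ℝ (secTan 0) = secTan 1 := by
  simp [secTan, derivative_sec]

theorem derivative_secTan_succ (m : ℕ) :
    derivative ℝ (secTan (m + 1)) = secTan m + C ((m + 2 : ℝ) ^ 2) * secTan (m + 2) := by
  have h1 : ((m + 1)! : ℝ)⁻¹ * (m + 1) = (m ! : ℝ)⁻¹ := by
    rw [Nat.factorial_succ]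
    push_cast
    field_simp
  have h2 : ((m + 1)! : ℝ)⁻¹ * (m + 2) = (m + 2) ^ 2 * ((m + 2)! : ℝ)⁻¹ := by
    rw [Nat.factorial_succ (m + 1)]
    push_cast
    field_simp
    ring
  have h1' := congrArg (C (R := ℝ)) h1
  have h2' := congrArg (C (R := ℝ)) h2
  rw [map_mul] at h1'
  rw [map_mul, map_mul] at h2'
  rw [secTan, Derivation.leibniz, derivative_C, smul_zero, add_zero, smul_eq_mul,
    derivative_sec_mul_tan_pow_succ, secTan, secTan]
  linear_combination sec * tan ^ m * h1' + sec * tan ^ (m + 2) * h2'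

/-- The value at zero of the `N`-th derivative of `sec x * tan x ^ m / m!`. -/
noncomputable def secTanDeriv (m N : ℕ) : ℝ := N ! * coeff N (secTan m)

theorem factorial_mul_coeff_derivative (f : PowerSeries ℝ) (N : ℕ) :
    ((N + 1)! : ℝ) * coeff (N + 1) f = N ! * coeff N (derivative ℝ f) := by
  rw [coeff_derivative, Nat.factorial_succ]
  push_cast
  ring

theorem secTanDeriv_zero_zero : secTanDeriv 0 0 = 1 := by
  simp [secTanDeriv, secTan, constantCoeff_sec]

theorem secTanDeriv_succ_zero (m : ℕ) : secTanDeriv (m + 1) 0 = 0 := by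
  simp [secTanDeriv, secTan, constantCoeff_tan]

theorem secTanDeriv_zero_succ (N : ℕ) : secTanDeriv 0 (N + 1) = secTanDeriv 1 N := by
  rw [secTanDeriv, factorial_mul_coeff_derivative, derivative_secTan_zero, secTanDeriv]

theorem secTanDeriv_succ_succ (m N : ℕ) :
    secTanDeriv (m + 1) (N + 1) =
      secTanDeriv m N + (m + 2 : ℝ) ^ 2 * secTanDeriv (m + 2) N := by
  rw [secTanDeriv, factorial_mul_coeff_derivative, derivative_secTan_succ, map_add,
    coeff_C_mul, secTanDeriv, secTanDeriv]
  ring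

theorem secTanDeriv_eq_zero_of_lt {m N : ℕ} (h : N < m) : secTanDeriv m N = 0 := by
  induction N generalizing m with
  | zero =>
    obtain ⟨m, rfl⟩ := Nat.exists_eq_succ_of_ne_zero h.ne'
    exact secTanDeriv_succ_zero m
  | succ N ih =>
    obtain ⟨m, rfl⟩ := Nat.exists_eq_succ_of_ne_zero (Nat.ne_zero_of_lt h)
    rw [Nat.succ_eq_add_one, secTanDeriv_succ_succ, ih (by omega), ih (by omega)]
    ring

end PowerSeries

open PowerSeries in
theorem Delta_sq_eq_secTanDeriv (m j : ℕ) :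
    Delta (fun k => (k : ℝ) ^ 2) (m + 1) j = secTanDeriv m (m + 2 * j) := by
  induction j generalizing m with
  | zero =>
    rw [Delta_zero_right]
    induction m with
    | zero => exact secTanDeriv_zero_zero.symm
    | succ m ih =>
      rw [mul_zero, add_zero, secTanDeriv_succ_succ,
        secTanDeriv_eq_zero_of_lt (show m < m + 2 by omega), mul_zero, add_zero]
      exact ih
  | succ j ih =>
    induction m with
    | zero =>
      rw [Delta_succ_succ, Delta_zero_succ, ih 1, show 0 + 2 * (j + 1) = 1 + 2 * j + 1 by ring,
        secTanDeriv_zero_succ]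
      simp
    | succ m ihm =>
      rw [Delta_succ_succ, ihm, ih (m + 2), show m + 1 + 2 * (j + 1) = m + 2 * (j + 1) + 1 by ring,
        secTanDeriv_succ_succ, show m + 2 + 2 * j = m + 2 * (j + 1) by ring]
      push_cast
      ring

theorem Finset.sum_range_two_mul_add_one_of_odd_eq_zero {M : Type*} [AddCommMonoid M] (f : ℕ → M)
    (hf : ∀ k, f (2 * k + 1) = 0) (n : ℕ) :
    ∑ k ∈ Finset.range (2 * n + 1), f k = ∑ k ∈ Finset.range (n + 1), f (2 * k) := by
  induction n with
  | zero => simp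
  | succ n ih =>
    rw [Finset.sum_range_succ _ (n + 1), ← ih, show 2 * (n + 1) + 1 = 2 * n + 1 + 1 + 1 by ring,
      Finset.sum_range_succ, Finset.sum_range_succ, hf, add_zero]
    rfl

open PowerSeries in
open scoped Nat in
theorem sum_choose_mul_Delta_sq {n : ℕ} (hn : 1 ≤ n) :
    ∑ k ∈ Finset.range (n + 1), (-1 : ℝ) ^ k * (Nat.choose (2 * n) (2 * k) : ℝ) *
      Delta (fun k => (k : ℝ) ^ 2) 1 (n - k) = 0 := by
  have h := congrArg (coeff (2 * n)) cos_mul_sec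
  rw [coeff_mul, Finset.Nat.sum_antidiagonal_eq_sum_range_succ_mk, coeff_one,
    if_neg (by omega), Nat.succ_eq_add_one, Finset.sum_range_two_mul_add_one_of_odd_eq_zero] at h
  · rw [← mul_zero ((2 * n)! : ℝ), ← h, Finset.mul_sum]
    refine Finset.sum_congr rfl fun k hk => ?_
    have hk' : k ≤ n := Nat.lt_succ_iff.mp (Finset.mem_range.mp hk)
    have hsub : 2 * n - 2 * k = 2 * (n - k) := by omega
    rw [Delta_sq_eq_secTanDeriv 0, secTanDeriv, zero_add,
      Nat.cast_choose ℝ (show 2 * k ≤ 2 * n by omega), hsub, cos, coeff_mk, if_pos (by simp)]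
    simp only [eq_ratCast, secTan]
    push_cast
    simp
    field_simp
  · intro k
    simp [cos]

theorem eq_of_sum_choose_eq_zero {D E : ℕ → ℝ} (h0 : D 0 = E 0)
    (hD : ∀ n : ℕ, 1 ≤ n → ∑ k ∈ Finset.range (n + 1),
      (-1 : ℝ) ^ k * (Nat.choose (2 * n) (2 * k) : ℝ) * D (n - k) = 0)
    (hE : ∀ n : ℕ, 1 ≤ n → ∑ k ∈ Finset.range (n + 1),
      (-1 : ℝ) ^ k * (Nat.choose (2 * n) (2 * k) : ℝ) * E (n - k) = 0) (j : ℕ) :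
    D j = E j := by
  induction j using Nat.strong_induction_on with
  | _ j ih =>
    rcases Nat.eq_zero_or_pos j with rfl | hj
    · exact h0
    have h := (hD j hj).trans (hE j hj).symm
    rw [Finset.sum_range_succ', Finset.sum_range_succ',
      Finset.sum_congr rfl fun k _ => by rw [ih (j - (k + 1)) (by omega)]] at h
    simpa using h

/-- For `F(k) = k²` and `D_j = Δ_F(1, j)`, one has `D_0 = 1` and
`∑_{k=0}^{n} (−1)^k C(2n,2k) D_{n−k} = 0` for all `n ≥ 1`; consequently `D_j` equals
the `j`-th Euler number `E_j`, i.e. `D = E` for any sequence `E` satisfying the same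
recurrence `E_0 = 1`, `∑_{k=0}^{n} (−1)^k C(2n,2k) E_{n−k} = 0`. -/
theorem delta_eq_euler_numbers :
    (Delta (fun k => (k : ℝ) ^ 2) 1 0 = 1 ∧
      ∀ n : ℕ, 1 ≤ n →
        ∑ k ∈ Finset.range (n + 1),
          (-1 : ℝ) ^ k * (Nat.choose (2 * n) (2 * k) : ℝ) *
            Delta (fun k => (k : ℝ) ^ 2) 1 (n - k) = 0) ∧
    (∀ E : ℕ → ℝ, E 0 = 1 →
      (∀ n : ℕ, 1 ≤ n →
        ∑ k ∈ Finset.range (n + 1),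
          (-1 : ℝ) ^ k * (Nat.choose (2 * n) (2 * k) : ℝ) * E (n - k) = 0) →
      ∀ j : ℕ, Delta (fun k => (k : ℝ) ^ 2) 1 j = E j) := by
  have h0 : Delta (fun k => (k : ℝ) ^ 2) 1 0 = 1 := Delta_zero_right _ _
  have hsum := fun n (hn : 1 ≤ n) => sum_choose_mul_Delta_sq hn
  exact ⟨⟨h0, hsum⟩, fun E hE0 hE => eq_of_sum_choose_eq_zero (h0.trans hE0.symm) hsum hE⟩
end
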